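/- Let d ≥ 1, a > d/2 and l > 0, and define F(ω) = ∫_{ℝ^d} (1 + ‖x‖²/(2al²))^{-a} · exp(-i⟨ω,x⟩) dx for ω ∈ ℝ^d. Then for every ω ∈ ℝ^d, F(ω) is a real number and F(ω) > 0 (i.e., its imaginary part vanishes and its real part is strictly positive). -/

import Mathlib

open MeasureTheory
open scoped RealInnerProductSpace

open Real Set in
/-- The Gamma-mixture integrand. -/
noncomputable def rqG (d : ℕ) (a c : ℝ) (ω : EuclideanSpace ℝ (Fin d))
    (x : EuclideanSpace ℝ (Fin d)) (t : ℝ) : ℂ :=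
  ((t ^ (a - 1) * Real.exp (-((1 + c * ‖x‖ ^ 2) * t)) : ℝ) : ℂ) *
    Complex.exp (-Complex.I * ((⟪ω, x⟫ : ℝ) : ℂ))

open Real Set in
lemma rqG_norm (d : ℕ) (a c : ℝ) (ω x : EuclideanSpace ℝ (Fin d)) {t : ℝ} (ht : 0 < t) :
    ‖rqG d a c ω x t‖ = t ^ (a - 1) * Real.exp (-((1 + c * ‖x‖ ^ 2) * t)) := by
  unfold rqG
  rw [norm_mul, Complex.norm_exp, Complex.norm_real, Real.norm_of_nonneg (by positivity)]
  simp

open Real Set in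
lemma rq_integrable (d : ℕ) (a c : ℝ) (ha : (d : ℝ) / 2 < a) (hc : 0 < c) :
    Integrable (fun x : EuclideanSpace ℝ (Fin d) => (1 + c * ‖x‖ ^ 2) ^ (-a)) := by
  have h := integrable_rpow_neg_one_add_norm_sq (E := EuclideanSpace ℝ (Fin d))
    (μ := volume) (r := 2 * a) (by simp; linarith)
  have h2 := h.comp_smul (R := √c) (by positivity)
  refine h2.congr (Filter.Eventually.of_forall fun x => ?_)
  simp only [norm_smul, mul_pow, Real.norm_eq_abs, sq_abs, Real.sq_sqrt hc.le]
  congr 1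
  ring

open Real Set in
lemma rqG_integral_t (d : ℕ) (a c : ℝ) (ha : 0 < a) (hc : 0 < c)
    (ω x : EuclideanSpace ℝ (Fin d)) :
    ∫ t in Ioi (0:ℝ), t ^ (a - 1) * Real.exp (-((1 + c * ‖x‖ ^ 2) * t))
      = (1 + c * ‖x‖ ^ 2) ^ (-a) * Real.Gamma a := by
  have hr : 0 < 1 + c * ‖x‖ ^ 2 := by positivity
  rw [integral_rpow_mul_exp_neg_mul_Ioi ha hr, one_div, Real.inv_rpow hr.le, Real.rpow_neg hr.le]

open Real Set in
lemma rqG_integrable (d : ℕ) (a c : ℝ) (ha : (d : ℝ) / 2 < a) (hc : 0 < c)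
    (ω : EuclideanSpace ℝ (Fin d)) :
    Integrable (Function.uncurry (rqG d a c ω))
      ((volume : Measure (EuclideanSpace ℝ (Fin d))).prod (volume.restrict (Ioi (0:ℝ)))) := by
  have ha0 : 0 < a := lt_of_le_of_lt (by positivity) ha
  have hm : Measurable (Function.uncurry (rqG d a c ω)) := by
    unfold rqG Function.uncurry
    fun_prop
  rw [integrable_prod_iff hm.aestronglyMeasurable]
  constructor
  · refine Filter.Eventually.of_forall fun x => ?_
    have hr : 0 < 1 + c * ‖x‖ ^ 2 := by positivity
    have h0 : IntegrableOn (fun t : ℝ => t ^ (a - 1) * Real.exp (-((1 + c * ‖x‖ ^ 2) * t)))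
        (Ioi 0) := by
      refine .of_integral_ne_zero ?_
      rw [rqG_integral_t d a c ha0 hc ω x]
      have := Real.Gamma_pos_of_pos ha0
      positivity
    refine Integrable.mono' h0 (hm.comp measurable_prodMk_left).aestronglyMeasurable ?_
    filter_upwards [ae_restrict_mem measurableSet_Ioi] with t ht
    exact (rqG_norm d a c ω x ht).le
  · refine ((rq_integrable d a c ha hc).mul_const (Real.Gamma a)).congr
      (Filter.Eventually.of_forall fun x => ?_)
    simp only
    rw [← rqG_integral_t d a c ha0 hc ω x]
    exact setIntegral_congr_fun measurableSet_Ioi fun t ht => (rqG_norm d a c ω x ht).symm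

open Real Set in
/-- The inner Gaussian integral. -/
noncomputable def rqg (d : ℕ) (a c : ℝ) (ω : EuclideanSpace ℝ (Fin d)) (t : ℝ) : ℝ :=
  t ^ (a - 1) * Real.exp (-t) * ((π / (c * t)) ^ ((d : ℝ) / 2) *
    Real.exp (-‖ω‖ ^ 2 / (4 * (c * t))))

open Real Set in
lemma rqG_integral_x (d : ℕ) (a c : ℝ) (hc : 0 < c)
    (ω : EuclideanSpace ℝ (Fin d)) {t : ℝ} (ht : 0 < t) :
    ∫ x, rqG d a c ω x t = (rqg d a c ω t : ℂ) := by
  have hb : 0 < ((c * t : ℝ) : ℂ).re := by rw [Complex.ofReal_re]; positivity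
  have h := GaussianFourier.integral_cexp_neg_mul_sq_norm_add hb (-Complex.I) ω
  have e : ∀ x, rqG d a c ω x t = ((t ^ (a - 1) * Real.exp (-t) : ℝ) : ℂ) *
      Complex.exp (-((c * t : ℝ) : ℂ) * (‖x‖ : ℂ) ^ 2 + -Complex.I * ((⟪ω, x⟫ : ℝ) : ℂ)) := by
    intro x
    unfold rqG
    rw [Complex.exp_add, ← mul_assoc]
    congr 1
    rw [show -((c * t : ℝ) : ℂ) * (‖x‖ : ℂ) ^ 2 = ((-(c * t) * ‖x‖ ^ 2 : ℝ) : ℂ) by push_cast; ring,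
      ← Complex.ofReal_exp, ← Complex.ofReal_mul, mul_assoc, ← Real.exp_add]
    congr 3
    ring_nf
  simp_rw [e]
  rw [integral_const_mul, h]
  unfold rqg
  rw [Complex.ofReal_mul (t ^ (a - 1) * Real.exp (-t)), Complex.ofReal_mul ((π / (c * t)) ^ ((d : ℝ) / 2)),
    Complex.ofReal_cpow (by positivity)]
  congr 2
  · push_cast
    simp
  · push_cast
    simp

/-- The Fourier transform of the rational-quadratic kernel on `ℝ^d` is real-valued and
strictly positive: its imaginary part vanishes and its real part is positive. -/
theorem rationalQuadratic_fourier_real_pos (d : ℕ) (hd : 1 ≤ d)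
    (a l : ℝ) (ha : (d : ℝ) / 2 < a) (hl : 0 < l)
    (ω : EuclideanSpace ℝ (Fin d)) :
    (∫ x : EuclideanSpace ℝ (Fin d),
        (((1 + ‖x‖ ^ 2 / (2 * a * l ^ 2)) ^ (-a) : ℝ) : ℂ) *
          Complex.exp (-Complex.I * ((⟪ω, x⟫ : ℝ) : ℂ))).im = 0 ∧
    0 < (∫ x : EuclideanSpace ℝ (Fin d),
        (((1 + ‖x‖ ^ 2 / (2 * a * l ^ 2)) ^ (-a) : ℝ) : ℂ) *
          Complex.exp (-Complex.I * ((⟪ω, x⟫ : ℝ) : ℂ))).re := by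
  have ha0 : 0 < a := lt_of_le_of_lt (by positivity) ha
  have hΓ := Real.Gamma_pos_of_pos ha0
  obtain ⟨c, hc⟩ : ∃ c, c = (2 * a * l ^ 2)⁻¹ := ⟨_, rfl⟩
  have hc0 : 0 < c := by rw [hc]; positivity
  have hG := rqG_integrable d a c ha hc0 ω
  have hgC : Integrable (fun t => (rqg d a c ω t : ℂ)) (volume.restrict (Set.Ioi (0:ℝ))) := by
    refine hG.integral_prod_right.congr ?_
    filter_upwards [ae_restrict_mem measurableSet_Ioi] with t ht
    exact rqG_integral_x d a c hc0 ω ht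
  have hg : Integrable (rqg d a c ω) (volume.restrict (Set.Ioi (0:ℝ))) := by
    simpa using hgC.re
  have hgpos : ∀ t ∈ Set.Ioi (0:ℝ), 0 < rqg d a c ω t := by
    intro t ht
    have ht : 0 < t := ht
    have := Real.pi_pos
    unfold rqg
    positivity
  have hpos : 0 < ∫ t in Set.Ioi (0:ℝ), rqg d a c ω t := by
    rw [setIntegral_pos_iff_support_of_nonneg_ae]
    · rw [Set.inter_eq_right.mpr (show Set.Ioi (0:ℝ) ⊆ Function.support (rqg d a c ω) from
        fun t ht => (hgpos t ht).ne')]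
      simp
    · filter_upwards [ae_restrict_mem measurableSet_Ioi] with t ht
      exact (hgpos t ht).le
    · exact hg
  have key : (∫ x : EuclideanSpace ℝ (Fin d),
        (((1 + ‖x‖ ^ 2 / (2 * a * l ^ 2)) ^ (-a) : ℝ) : ℂ) *
          Complex.exp (-Complex.I * ((⟪ω, x⟫ : ℝ) : ℂ)))
      = (((Real.Gamma a)⁻¹ * ∫ t in Set.Ioi (0:ℝ), rqg d a c ω t : ℝ) : ℂ) := by
    have hsw := integral_integral_swap hG
    have hR : ∫ t in Set.Ioi (0:ℝ), ∫ x, rqG d a c ω x t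
        = ((∫ t in Set.Ioi (0:ℝ), rqg d a c ω t : ℝ) : ℂ) := by
      rw [← integral_complex_ofReal]
      exact setIntegral_congr_fun measurableSet_Ioi fun t ht => rqG_integral_x d a c hc0 ω ht
    rw [Complex.ofReal_mul, ← hR, ← hsw, ← integral_const_mul]
    congr 1
    ext x
    unfold rqG
    rw [integral_mul_const, integral_complex_ofReal, rqG_integral_t d a c ha0 hc0 ω x,
      ← mul_assoc, ← Complex.ofReal_mul, hc]
    congr 2
    field_simp
  rw [key, Complex.ofReal_im, Complex.ofReal_re]
  exact ⟨rfl, by positivity⟩
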